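/- For all m, n ≥ 1, F_{m+n}^I(x,y,q) = F_m^I(xq^n, yq^{2n}, q)·F_n^I(x,y,q) + y·q^{2(n−1)}·F_{m−1}^I(xq^{n+1}, yq^{2(n+1)}, q)·F_{n−1}^I(x,y,q), as an identity in ℤ[x,y,q], where F_m^I(xq^n, yq^{2n}, q) denotes Σ_{σ ∈ S_m(123,132,213)} (xq^n)^{s(σ)} (yq^{2n})^{d(σ)} q^{inv(σ)}, and similarly for the other substituted term. -/

import Mathlib

open Finset MvPolynomial

open scoped Classical

/-- `σ` (a permutation of `[n]` in one-line notation `σ 0, …, σ (n-1)`) contains the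
pattern `π` (given by its one-line notation as a function `Fin m → Fin m`) if some
subsequence of `σ` is order isomorphic to `π`. -/
def PermContains {n m : ℕ} (σ : Equiv.Perm (Fin n)) (π : Fin m → Fin m) : Prop :=
  ∃ f : Fin m → Fin n, (∀ a b : Fin m, a < b → f a < f b) ∧
    ∀ a b : Fin m, σ (f a) < σ (f b) ↔ π a < π b

/-- `σ` avoids the pattern `π`. -/
def PermAvoids {n m : ℕ} (σ : Equiv.Perm (Fin n)) (π : Fin m → Fin m) : Prop :=
  ¬ PermContains σ π

/-- The value `σ i` of the one-line notation of `σ`, as a natural number (0-based). -/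
def permVal {n : ℕ} (σ : Equiv.Perm (Fin n)) (i : ℕ) : ℕ :=
  if h : i < n then (σ ⟨i, h⟩ : ℕ) else 0

/-- `inv σ` : the number of inversions, i.e. pairs of positions `i < j` with `σ i > σ j`. -/
def invStat {n : ℕ} (σ : Equiv.Perm (Fin n)) : ℕ :=
  ((Finset.range n ×ˢ Finset.range n).filter
    fun p => p.1 < p.2 ∧ permVal σ p.2 < permVal σ p.1).card

/-- `maj σ` : the sum of all (1-based) indices `i` with `σ(i) > σ(i+1)`; with 0-based
positions, a descent at positions `i, i+1` contributes `i + 1`. -/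
def majStat {n : ℕ} (σ : Equiv.Perm (Fin n)) : ℕ :=
  ∑ i ∈ Finset.range (n - 1), if permVal σ (i + 1) < permVal σ i then i + 1 else 0

/-- The number of ascents of `σ`; for `σ ∈ Sₙ(123,132,213)` (a reverse layered matching)
this equals `d σ`, the number of doubleton blocks. -/
def ascStat {n : ℕ} (σ : Equiv.Perm (Fin n)) : ℕ :=
  ((Finset.range (n - 1)).filter fun i => permVal σ i < permVal σ (i + 1)).card

/-- The number of descents of `σ`; for `σ ∈ Sₙ(231,312,321)` (a layered matching)
this equals `d σ`, the number of doubleton blocks. -/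
def descStat {n : ℕ} (σ : Equiv.Perm (Fin n)) : ℕ :=
  ((Finset.range (n - 1)).filter fun i => permVal σ (i + 1) < permVal σ i).card

/-- `Sₙ(123, 132, 213)` : permutations of `[n]` avoiding `123`, `132` and `213`
(patterns written 0-based). -/
noncomputable def S123 (n : ℕ) : Finset (Equiv.Perm (Fin n)) :=
  Finset.univ.filter fun σ =>
    PermAvoids σ ![0, 1, 2] ∧ PermAvoids σ ![0, 2, 1] ∧ PermAvoids σ ![1, 0, 2]

/-- `Sₙ(231, 312, 321)` : permutations of `[n]` avoiding `231`, `312` and `321`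
(patterns written 0-based). -/
noncomputable def S231 (n : ℕ) : Finset (Equiv.Perm (Fin n)) :=
  Finset.univ.filter fun σ =>
    PermAvoids σ ![1, 2, 0] ∧ PermAvoids σ ![2, 0, 1] ∧ PermAvoids σ ![2, 1, 0]

/-- `Fₙᴵ(x, y, q) = Σ_{σ ∈ Sₙ(123,132,213)} x^(s σ) * y^(d σ) * q^(inv σ)` in `ℤ[x,y,q]`,
with arbitrary arguments `x y q` substituted for the variables. -/
noncomputable def FIgen (n : ℕ) (x y q : MvPolynomial (Fin 3) ℤ) : MvPolynomial (Fin 3) ℤ :=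
  ∑ σ ∈ S123 n, x ^ (n - 2 * ascStat σ) * y ^ ascStat σ * q ^ invStat σ

/-- Avoiding `123`, `132` and `213` means that entries at distance at least two are decreasing. -/
theorem mem_S123_iff {n : ℕ} (σ : Equiv.Perm (Fin n)) :
    σ ∈ S123 n ↔ ∀ i k : Fin n, (i : ℕ) + 2 ≤ k → σ k < σ i := by
  simp only [S123, Finset.mem_filter, Finset.mem_univ, true_and, PermAvoids, PermContains,
    not_exists, not_and]
  constructor
  · rintro ⟨h1, h2, h3⟩ i k hik
    by_contra hlt
    have hne : σ i ≠ σ k := fun h => by have := σ.injective h; subst this; omega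
    let j : Fin n := ⟨i + 1, by omega⟩
    have hij : i < j := Fin.lt_def.2 (by simp [j])
    have hjk : j < k := Fin.lt_def.2 (by simp [j]; omega)
    have hij' : σ i ≠ σ j := fun h => hij.ne (σ.injective h)
    have hjk' : σ j ≠ σ k := fun h => hjk.ne (σ.injective h)
    have hm : ∀ a b : Fin 3, a < b → (![i, j, k] : Fin 3 → Fin n) a < ![i, j, k] b := by
      intro a b hab
      fin_cases a <;> fin_cases b <;> simp at hab ⊢ <;> first | assumption | exact hij.trans hjk
    specialize h1 _ hm
    specialize h2 _ hm
    specialize h3 _ hm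
    simp only [Fin.forall_fin_succ] at h1 h2 h3
    simp at h1 h2 h3
    grind
  · intro h
    refine ⟨?_, ?_, ?_⟩ <;> intro f hf hc <;>
    · have h01 := hf 0 1 (by decide)
      have h12 := hf 1 2 (by decide)
      have h02 := h (f 0) (f 2) (by simp only [Fin.lt_def] at h01 h12; omega)
      have := (hc 0 2).2 (by decide)
      exact lt_asymm h02 this

theorem invStat_eq_sum {n : ℕ} (σ : Equiv.Perm (Fin n)) :
    invStat σ = ∑ i : Fin n, ∑ j : Fin n, if i < j ∧ σ j < σ i then 1 else 0 := by
  rw [invStat, Finset.card_filter, Finset.sum_product, Finset.sum_range]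
  refine Finset.sum_congr rfl fun i _ => ?_
  rw [Finset.sum_range]
  simp [permVal]

theorem ascStat_eq_sum {n : ℕ} (σ : Equiv.Perm (Fin n)) :
    ascStat σ = ∑ i : Fin n, ∑ j : Fin n, if (i : ℕ) + 1 = j ∧ σ i < σ j then 1 else 0 := by
  have h : ascStat σ = ((Finset.range n ×ˢ Finset.range n).filter
      fun p => p.1 + 1 = p.2 ∧ permVal σ p.1 < permVal σ p.2).card := by
    refine Finset.card_bij (fun i _ => (i, i + 1)) ?_ ?_ ?_
    · intro i hi
      simp only [Finset.mem_filter, Finset.mem_range, Finset.mem_product] at hi ⊢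
      exact ⟨by omega, trivial, hi.2⟩
    · intro i _ j _ hij
      exact (Prod.mk.inj hij).1
    · rintro ⟨i, j⟩ hij
      simp only [Finset.mem_filter, Finset.mem_range, Finset.mem_product] at hij
      obtain ⟨⟨hi, hj⟩, rfl, hlt⟩ := hij
      exact ⟨i, by simp only [Finset.mem_filter, Finset.mem_range]; exact ⟨by omega, hlt⟩, rfl⟩
  rw [h, Finset.card_filter, Finset.sum_product, Finset.sum_range]
  refine Finset.sum_congr rfl fun i _ => ?_
  rw [Finset.sum_range]
  simp [permVal]

/-- The permutation whose one-line notation is that of `σ` preceded by a new maximum. -/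
def consMax {n : ℕ} (σ : Equiv.Perm (Fin n)) : Equiv.Perm (Fin (n + 1)) :=
  ((finSuccEquiv n).trans σ.optionCongr).trans finSuccEquivLast.symm

@[simp]
theorem consMax_zero {n : ℕ} (σ : Equiv.Perm (Fin n)) : consMax σ 0 = Fin.last n := by
  simp [consMax]

@[simp]
theorem consMax_succ {n : ℕ} (σ : Equiv.Perm (Fin n)) (i : Fin n) :
    consMax σ i.succ = (σ i).castSucc := by
  simp [consMax]

theorem consMax_injective {n : ℕ} : Function.Injective (consMax (n := n)) := by
  intro σ τ h
  ext i
  have := congrArg (fun e => (e i.succ : ℕ)) h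
  simpa using this

theorem exists_consMax_eq {n : ℕ} (σ : Equiv.Perm (Fin (n + 1))) (h : σ 0 = Fin.last n) :
    ∃ τ, consMax τ = σ := by
  have hne : ∀ i : Fin n, σ i.succ ≠ Fin.last n := fun i hi =>
    Fin.succ_ne_zero i (σ.injective (hi.trans h.symm))
  have hinj : Function.Injective fun i : Fin n => (σ i.succ).castPred (hne i) := by
    intro i j hij
    simpa using hij
  refine ⟨Equiv.ofBijective _ (Finite.injective_iff_bijective.1 hinj), ?_⟩
  ext i
  refine Fin.cases ?_ (fun i => ?_) i
  · simp [h]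
  · simp

/-- The permutation whose one-line notation is that of `σ` preceded by an ascending block
consisting of the two largest values. -/
def consBlock {n : ℕ} (σ : Equiv.Perm (Fin n)) : Equiv.Perm (Fin (n + 2)) :=
  (Equiv.swap 0 1).trans (consMax (consMax σ))

@[simp]
theorem consBlock_zero {n : ℕ} (σ : Equiv.Perm (Fin n)) :
    consBlock σ 0 = (Fin.last n).castSucc := by
  simp only [consBlock, Equiv.trans_apply, Equiv.swap_apply_left]
  rw [← Fin.succ_zero_eq_one, consMax_succ, consMax_zero]

@[simp]
theorem consBlock_one {n : ℕ} (σ : Equiv.Perm (Fin n)) :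
    consBlock σ 1 = Fin.last (n + 1) := by
  simp [consBlock]

@[simp]
theorem consBlock_succ_succ {n : ℕ} (σ : Equiv.Perm (Fin n)) (i : Fin n) :
    consBlock σ i.succ.succ = (σ i).castSucc.castSucc := by
  rw [consBlock, Equiv.trans_apply, Equiv.swap_apply_of_ne_of_ne (Fin.succ_ne_zero _)]
  · simp
  · rw [← Fin.succ_zero_eq_one]
    exact fun h => Fin.succ_ne_zero _ (Fin.succ_injective _ h)

theorem consBlock_injective {n : ℕ} : Function.Injective (consBlock (n := n)) := by
  intro σ τ h
  ext i
  have := congrArg (fun e => (e i.succ.succ : ℕ)) h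
  simpa using this

theorem consMax_mem_S123 {n : ℕ} (σ : Equiv.Perm (Fin n)) :
    consMax σ ∈ S123 (n + 1) ↔ σ ∈ S123 n := by
  simp only [mem_S123_iff, Fin.forall_fin_succ (n := n)]
  simp [Fin.castSucc_lt_last]

theorem consBlock_mem_S123 {n : ℕ} (σ : Equiv.Perm (Fin n)) :
    consBlock σ ∈ S123 (n + 2) ↔ σ ∈ S123 n := by
  simp only [mem_S123_iff, Fin.forall_fin_succ (n := n + 1), Fin.forall_fin_succ (n := n)]
  simp only [Nat.add_le_add_iff_right, Fin.val_succ, add_right_comm _ 1 2]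
  simp [Fin.castSucc_lt_last, ← Nat.lt_iff_add_one_le]

theorem invStat_consMax {n : ℕ} (σ : Equiv.Perm (Fin n)) :
    invStat (consMax σ) = n + invStat σ := by
  simp only [invStat_eq_sum, Fin.sum_univ_succ]
  simp [Fin.castSucc_lt_last]

theorem invStat_consBlock {n : ℕ} (σ : Equiv.Perm (Fin n)) :
    invStat (consBlock σ) = 2 * n + invStat σ := by
  simp only [invStat_eq_sum, Fin.sum_univ_succ]
  have h1 (i : Fin n) : (1 : Fin (n + 2)) < i.succ.succ := by simp [Fin.lt_def]
  simp [Fin.castSucc_lt_last, h1, (Fin.le_last _).not_gt]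
  ring

theorem ascStat_consMax {n : ℕ} (σ : Equiv.Perm (Fin n)) :
    ascStat (consMax σ) = ascStat σ := by
  simp only [ascStat_eq_sum, Fin.sum_univ_succ]
  simp [(Fin.le_last _).not_gt]

theorem ascStat_consBlock {n : ℕ} (σ : Equiv.Perm (Fin n)) :
    ascStat (consBlock σ) = ascStat σ + 1 := by
  simp only [ascStat_eq_sum, Fin.sum_univ_succ]
  simp [(Fin.le_last _).not_gt]
  ring

theorem S123_succ_succ (n : ℕ) :
    S123 (n + 2) = (S123 (n + 1)).image consMax ∪ (S123 n).image consBlock := by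
  ext σ
  simp only [Finset.mem_union, Finset.mem_image]
  constructor
  · intro h
    have hd := (mem_S123_iff σ).1 h
    by_cases h0 : σ 0 = Fin.last (n + 1)
    · obtain ⟨τ, rfl⟩ := exists_consMax_eq σ h0
      exact .inl ⟨τ, (consMax_mem_S123 τ).1 h, rfl⟩
    · have h1 : σ 1 = Fin.last (n + 1) := by
        obtain ⟨k, hk⟩ := σ.surjective (Fin.last (n + 1))
        have hk2 : ¬ 2 ≤ (k : ℕ) := fun h2 => by
          have := hd 0 k (by simpa using h2)
          rw [hk] at this
          exact absurd (Fin.le_last _) this.not_ge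
        have hk0 : k ≠ 0 := by rintro rfl; exact h0 hk
        have : k = 1 := by
          ext
          have : (k : ℕ) ≠ 0 := fun h => hk0 (Fin.ext h)
          simp; omega
        rwa [← this]
      obtain ⟨ρ, hρ⟩ := exists_consMax_eq ((Equiv.swap 0 1).trans σ) (by simpa using h1)
      have hρ0 : ρ 0 = Fin.last n := by
        obtain ⟨k, hk⟩ := ρ.surjective (Fin.last n)
        rcases Fin.eq_zero_or_eq_succ k with rfl | ⟨j, rfl⟩
        · exact hk
        · exfalso
          have e1 := congrArg (fun e => e j.succ.succ) hρ
          have e2 : (ρ 0).castSucc = σ 0 := by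
            rw [← consMax_succ, hρ]
            simp
          have hs : Equiv.swap (0 : Fin (n + 2)) 1 j.succ.succ = j.succ.succ := by
            refine Equiv.swap_apply_of_ne_of_ne (Fin.succ_ne_zero _) ?_
            rw [← Fin.succ_zero_eq_one]
            exact fun h => Fin.succ_ne_zero _ (Fin.succ_injective _ h)
          simp only [consMax_succ, Equiv.trans_apply, hs, hk] at e1
          have := hd 0 j.succ.succ (by simp)
          rw [← e1, ← e2, Fin.castSucc_lt_castSucc_iff] at this
          exact absurd (Fin.le_last _) this.not_ge
      obtain ⟨τ, rfl⟩ := exists_consMax_eq ρ hρ0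
      have hσ : consBlock τ = σ := by
        rw [consBlock, hρ]
        ext i
        simp
      subst hσ
      exact .inr ⟨τ, (consBlock_mem_S123 τ).1 h, rfl⟩
  · rintro (⟨τ, h, rfl⟩ | ⟨τ, h, rfl⟩)
    · exact (consMax_mem_S123 τ).2 h
    · exact (consBlock_mem_S123 τ).2 h

theorem disjoint_image_consMax_consBlock (n : ℕ) :
    Disjoint ((S123 (n + 1)).image consMax) ((S123 n).image consBlock) := by
  rw [Finset.disjoint_left]
  intro σ h1 h2
  obtain ⟨τ, -, rfl⟩ := Finset.mem_image.1 h1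
  obtain ⟨ρ, -, h⟩ := Finset.mem_image.1 h2
  have := congrArg (fun e => (e 0 : ℕ)) h
  simp at this

theorem two_mul_ascStat_le {n : ℕ} : ∀ σ ∈ S123 n, 2 * ascStat σ ≤ n := by
  induction n using Nat.twoStepInduction with
  | zero => intro σ _; simp [ascStat]
  | one => intro σ _; simp [ascStat]
  | more n ih1 ih2 =>
    intro σ hσ
    rw [S123_succ_succ, Finset.mem_union, Finset.mem_image, Finset.mem_image] at hσ
    rcases hσ with ⟨τ, h, rfl⟩ | ⟨τ, h, rfl⟩
    · have := ih2 τ h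
      rw [ascStat_consMax]
      omega
    · have := ih1 τ h
      rw [ascStat_consBlock]
      omega

theorem FIgen_zero (x y q : MvPolynomial (Fin 3) ℤ) : FIgen 0 x y q = 1 := by
  have : S123 0 = {1} := by
    ext σ
    simp [mem_S123_iff, Subsingleton.elim σ 1]
  simp [FIgen, this, ascStat, invStat]

theorem FIgen_one (x y q : MvPolynomial (Fin 3) ℤ) : FIgen 1 x y q = x := by
  have : S123 1 = {1} := by
    ext σ
    simp [mem_S123_iff, Subsingleton.elim σ 1]
  simp [FIgen, this, ascStat, invStat_eq_sum]

theorem FIgen_succ_succ (x y q : MvPolynomial (Fin 3) ℤ) (n : ℕ) :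
    FIgen (n + 2) x y q =
      x * q ^ (n + 1) * FIgen (n + 1) x y q + y * q ^ (2 * n) * FIgen n x y q := by
  rw [FIgen, S123_succ_succ, Finset.sum_union (disjoint_image_consMax_consBlock n),
    Finset.sum_image consMax_injective.injOn, Finset.sum_image consBlock_injective.injOn,
    FIgen, FIgen, Finset.mul_sum, Finset.mul_sum]
  refine congrArg₂ (· + ·) ?_ ?_
  · refine Finset.sum_congr rfl fun σ hσ => ?_
    have := two_mul_ascStat_le σ hσ
    rw [ascStat_consMax, invStat_consMax,
      show n + 2 - 2 * ascStat σ = (n + 1 - 2 * ascStat σ) + 1 by omega]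
    ring
  · refine Finset.sum_congr rfl fun σ _ => ?_
    rw [ascStat_consBlock, invStat_consBlock,
      show n + 2 - 2 * (ascStat σ + 1) = n - 2 * ascStat σ by omega]
    ring

theorem FIgen_add (x y q : MvPolynomial (Fin 3) ℤ) (m n : ℕ) :
    FIgen (m + 1 + (n + 1)) x y q =
      FIgen (m + 1) (x * q ^ (n + 1)) (y * q ^ (2 * (n + 1))) q * FIgen (n + 1) x y q +
        y * q ^ (2 * n) * FIgen m (x * q ^ (n + 2)) (y * q ^ (2 * (n + 2))) q *
          FIgen n x y q := by
  induction m using Nat.twoStepInduction with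
  | zero =>
    rw [show 0 + 1 + (n + 1) = n + 2 by ring, FIgen_succ_succ, zero_add, FIgen_one, FIgen_zero]
    ring
  | one =>
    rw [show 1 + 1 + (n + 1) = n + 1 + 2 by ring, FIgen_succ_succ, FIgen_succ_succ _ _ _ n,
      FIgen_succ_succ _ _ _ 0, zero_add, FIgen_one, FIgen_zero, FIgen_one]
    ring
  | more m ih1 ih2 =>
    rw [show m + 2 + 1 + (n + 1) = m + 1 + (n + 1) + 2 by ring, FIgen_succ_succ,
      show m + 1 + (n + 1) + 1 = m + 1 + 1 + (n + 1) by ring, ih1, ih2,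
      FIgen_succ_succ _ _ _ (m + 1), FIgen_succ_succ _ _ _ m,
      FIgen_succ_succ _ _ _ m]
    ring

/-- For `m, n ≥ 1`:
`F_{m+n}ᴵ(x,y,q) = Fₘᴵ(xqⁿ, yq^(2n), q) Fₙᴵ(x,y,q)
  + y q^(2(n-1)) F_{m-1}ᴵ(xq^(n+1), yq^(2(n+1)), q) F_{n-1}ᴵ(x,y,q)` in `ℤ[x,y,q]`. -/
theorem stmt9 (m n : ℕ) (hm : 1 ≤ m) (hn : 1 ≤ n) :
    FIgen (m + n) (X 0) (X 1) (X 2) =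
      FIgen m (X 0 * X 2 ^ n) (X 1 * X 2 ^ (2 * n)) (X 2) * FIgen n (X 0) (X 1) (X 2) +
        X 1 * X 2 ^ (2 * (n - 1)) *
          FIgen (m - 1) (X 0 * X 2 ^ (n + 1)) (X 1 * X 2 ^ (2 * (n + 1))) (X 2) *
          FIgen (n - 1) (X 0) (X 1) (X 2) := by
  obtain ⟨m, rfl⟩ := Nat.exists_eq_add_of_le' hm
  obtain ⟨n, rfl⟩ := Nat.exists_eq_add_of_le' hn
  exact FIgen_add (X 0) (X 1) (X 2) m n
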